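/- arXiv:1705.05004 — 2 statements merged into one kernel-verified Lean document; each statement's English description precedes it below -/
import Mathlib

section
/- Let T > 0, λ ∈ ℝ, and let B₁, B₂ : [0,T] → ℝ^{n×n} be continuous such that for i = 1,2 and every t ∈ [0,T] the symmetric part of Bᵢ(t) has all eigenvalues bounded above by λ. Let Φᵢ be the fundamental solutions of Φᵢ'(t) = Bᵢ(t) Φᵢ(t) with Φᵢ(0) = I. Then for all 0 ≤ t ≤ T, ‖Φ₁(t) - Φ₂(t)‖ ≤ (∫₀ᵗ ‖B₁(s) - B₂(s)‖ ds) · e^{λ t} in the ℓ² operator norm. -/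
open Matrix

attribute [local instance] Matrix.normedAddCommGroup Matrix.normedSpace

/-- The ℓ² operator norm of a real matrix. -/
noncomputable def l2OpNorm {n : ℕ} (A : Matrix (Fin n) (Fin n) ℝ) : ℝ :=
  ‖LinearMap.toContinuousLinearMap (Matrix.toEuclideanLin A)‖

open scoped Topology

section NormGrowth

variable {E : Type*} [NormedAddCommGroup E] [InnerProductSpace ℝ E]

/-- If `⟪u, u'⟫ ≤ ‖u‖ g`, then the growth of `‖u‖` is bounded by the integral of `g`. -/
theorem norm_le_add_integral_of_inner_deriv_le {T : ℝ} {u u' : ℝ → E} {g : ℝ → ℝ}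
    (hu : ∀ t ∈ Set.Icc 0 T, HasDerivWithinAt u (u' t) (Set.Icc 0 T) t)
    (hg : ContinuousOn g (Set.Icc 0 T)) (hg0 : ∀ t ∈ Set.Icc 0 T, 0 ≤ g t)
    (h : ∀ t ∈ Set.Icc 0 T, inner ℝ (u t) (u' t) ≤ ‖u t‖ * g t)
    {t : ℝ} (ht : t ∈ Set.Icc 0 T) :
    ‖u t‖ ≤ ‖u 0‖ + ∫ s in (0 : ℝ)..t, g s := by
  have hT : 0 ≤ T := ht.1.trans ht.2
  have hgi : MeasureTheory.IntegrableOn g (Set.uIcc 0 T) := by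
    rw [Set.uIcc_of_le hT]
    exact hg.integrableOn_Icc
  have hGcont : ContinuousOn (fun x => ∫ s in (0 : ℝ)..x, g s) (Set.Icc 0 T) := by
    simpa only [Set.uIcc_of_le hT] using
      intervalIntegral.continuousOn_primitive_interval hgi
  have hucont : ContinuousOn u (Set.Icc 0 T) := fun x hx => (hu x hx).continuousWithinAt
  refine le_of_forall_pos_le_add fun ε hε => ?_
  have hpos : ∀ x, 0 < ‖u x‖ ^ 2 + ε ^ 2 := fun x => by positivity
  have hanti : AntitoneOn (fun x => √(‖u x‖ ^ 2 + ε ^ 2) - ∫ s in (0 : ℝ)..x, g s)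
      (Set.Icc 0 T) := by
    refine antitoneOn_of_hasDerivWithinAt_nonpos (convex_Icc 0 T)
      (f' := fun x => 2 * inner ℝ (u x) (u' x) / (2 * √(‖u x‖ ^ 2 + ε ^ 2)) - g x) ?_ ?_ ?_
    · exact (((hucont.norm.pow 2).add continuousOn_const).sqrt).sub hGcont
    · intro x hx
      rw [interior_Icc] at hx
      have hnhds : Set.Icc 0 T ∈ 𝓝 x := Icc_mem_nhds hx.1 hx.2
      have hx' := Set.Ioo_subset_Icc_self hx
      have hsqrt := (((hu x hx').hasDerivAt hnhds).norm_sq.add_const (ε ^ 2)).sqrt (hpos x).ne'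
      have hint : HasDerivAt (fun x => ∫ s in (0 : ℝ)..x, g s) (g x) x := by
        refine intervalIntegral.integral_hasDerivAt_right ?_ ?_ (hg.continuousAt hnhds)
        · refine (hg.mono ?_).intervalIntegrable
          rw [Set.uIcc_of_le hx'.1]
          exact Set.Icc_subset_Icc_right hx'.2
        · exact ⟨_, hnhds, hg.aestronglyMeasurable measurableSet_Icc⟩
      exact (hsqrt.sub hint).hasDerivWithinAt
    · intro x hx
      have hx' := interior_subset hx
      have hle : ‖u x‖ ≤ √(‖u x‖ ^ 2 + ε ^ 2) :=
        Real.le_sqrt_of_sq_le (by nlinarith [sq_nonneg ε])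
      rw [sub_nonpos, mul_div_mul_left _ _ two_ne_zero, div_le_iff₀ (Real.sqrt_pos.2 (hpos x))]
      nlinarith [h x hx', mul_le_mul_of_nonneg_right hle (hg0 x hx')]
  have hle := hanti (Set.left_mem_Icc.2 hT) ht ht.1
  simp only [intervalIntegral.integral_same, sub_zero] at hle
  have h1 : ‖u t‖ ≤ √(‖u t‖ ^ 2 + ε ^ 2) :=
    Real.le_sqrt_of_sq_le (by nlinarith [sq_nonneg ε])
  have h2 : √(‖u 0‖ ^ 2 + ε ^ 2) ≤ ‖u 0‖ + ε :=
    Real.sqrt_le_iff.2 ⟨by positivity, by nlinarith [norm_nonneg (u 0)]⟩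
  linarith

/-- Weighted form of `norm_le_add_integral_of_inner_deriv_le`, allowing exponential growth at
rate `c`. -/
theorem norm_le_mul_exp_of_inner_deriv_le {T c : ℝ} {y y' : ℝ → E} {g : ℝ → ℝ}
    (hy : ∀ t ∈ Set.Icc 0 T, HasDerivWithinAt y (y' t) (Set.Icc 0 T) t)
    (hg : ContinuousOn g (Set.Icc 0 T)) (hg0 : ∀ t ∈ Set.Icc 0 T, 0 ≤ g t)
    (h : ∀ t ∈ Set.Icc 0 T,
      inner ℝ (y t) (y' t) ≤ c * ‖y t‖ ^ 2 + ‖y t‖ * (Real.exp (c * t) * g t))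
    {t : ℝ} (ht : t ∈ Set.Icc 0 T) :
    ‖y t‖ ≤ (‖y 0‖ + ∫ s in (0 : ℝ)..t, g s) * Real.exp (c * t) := by
  have hexp (x : ℝ) : HasDerivAt (fun x => Real.exp (-(c * x))) (Real.exp (-(c * x)) * -c) x := by
    simpa using (((hasDerivAt_id x).const_mul c).neg).exp
  have hmul (x : ℝ) : Real.exp (-(c * x)) * Real.exp (c * x) = 1 := by
    rw [← Real.exp_add, neg_add_cancel, Real.exp_zero]
  have key := norm_le_add_integral_of_inner_deriv_le (u := fun x => Real.exp (-(c * x)) • y x)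
    (fun x hx => (hexp x).hasDerivWithinAt.smul (hy x hx)) hg hg0 (fun x hx => ?_) ht
  · simp only [norm_smul, Real.norm_eq_abs, Real.abs_exp, mul_zero, neg_zero, Real.exp_zero, abs_one,
      one_mul] at key
    calc ‖y t‖ = (Real.exp (-(c * t)) * ‖y t‖) * Real.exp (c * t) := by
          linear_combination (-‖y t‖) * hmul t
      _ ≤ _ := by gcongr
  · simp only [inner_add_right, inner_smul_left, inner_smul_right, norm_smul, Real.norm_eq_abs,
      Real.abs_exp, real_inner_self_eq_norm_sq, RCLike.conj_to_real]
    have hx := mul_le_mul_of_nonneg_left (h x hx) (sq_nonneg (Real.exp (-(c * x))))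
    have e : Real.exp (-(c * x)) ^ 2 * (‖y x‖ * (Real.exp (c * x) * g x))
        = Real.exp (-(c * x)) * ‖y x‖ * g x := by
      linear_combination (Real.exp (-(c * x)) * ‖y x‖ * g x) * hmul x
    rw [mul_add, e] at hx
    linarith

end NormGrowth

section MatrixBounds

variable {n : ℕ}

/-- Spectral upper bounds on the symmetric part bound the quadratic form. -/
theorem inner_toEuclideanLin_le_of_spectrum_le {A : Matrix (Fin n) (Fin n) ℝ} {c : ℝ}
    (h : ∀ μ ∈ spectrum ℝ ((1 / 2 : ℝ) • (A + Aᵀ)), μ ≤ c) (v : EuclideanSpace ℝ (Fin n)) :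
    inner ℝ v (toEuclideanLin A v) ≤ c * ‖v‖ ^ 2 := by
  have hpos : (algebraMap ℝ (Matrix (Fin n) (Fin n) ℝ) c -
      (1 / 2 : ℝ) • (A + Aᵀ)).PosSemidef := by
    refine posSemidef_iff_isHermitian_and_spectrum_nonneg.2 ⟨?_, ?_⟩
    · rw [IsHermitian, conjTranspose_eq_transpose_of_trivial, algebraMap_eq_diagonal]
      simp [add_comm]
    · rw [← spectrum.singleton_sub_eq]
      rintro _ ⟨_, rfl, μ, hμ, rfl⟩
      exact sub_nonneg.2 (h μ hμ)
  have hq := hpos.dotProduct_mulVec_nonneg v.ofLp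
  have ht : v.ofLp ⬝ᵥ (Aᵀ *ᵥ v.ofLp) = v.ofLp ⬝ᵥ (A *ᵥ v.ofLp) := by
    rw [mulVec_transpose, dotProduct_comm, dotProduct_mulVec]
  have hn : v.ofLp ⬝ᵥ v.ofLp = ‖v‖ ^ 2 := by
    rw [← real_inner_self_eq_norm_sq, EuclideanSpace.inner_eq_star_dotProduct, star_trivial]
  rw [EuclideanSpace.inner_eq_star_dotProduct, star_trivial, toLpLin_apply,
    dotProduct_comm]
  rw [star_trivial, Algebra.algebraMap_eq_smul_one, sub_mulVec, smul_mulVec, smul_mulVec,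
    add_mulVec, one_mulVec, dotProduct_sub, dotProduct_smul, dotProduct_smul, dotProduct_add, ht,
    hn, smul_eq_mul, smul_eq_mul] at hq
  linarith

theorem l2OpNorm_nonneg (A : Matrix (Fin n) (Fin n) ℝ) : 0 ≤ l2OpNorm A :=
  norm_nonneg _

theorem norm_toEuclideanLin_le (A : Matrix (Fin n) (Fin n) ℝ) (v : EuclideanSpace ℝ (Fin n)) :
    ‖toEuclideanLin A v‖ ≤ l2OpNorm A * ‖v‖ :=
  (LinearMap.toContinuousLinearMap (toEuclideanLin A)).le_opNorm v

theorem continuous_l2OpNorm : Continuous (l2OpNorm (n := n)) :=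
  (LinearMap.continuous_of_finiteDimensional
    ((LinearMap.toContinuousLinearMap (𝕜 := ℝ) (E := EuclideanSpace ℝ (Fin n))
      (F' := EuclideanSpace ℝ (Fin n))).toLinearMap ∘ₗ
      (toEuclideanLin (𝕜 := ℝ) (m := Fin n) (n := Fin n)).toLinearMap)).norm

theorem hasDerivWithinAt_toEuclideanLin_apply {Φ : ℝ → Matrix (Fin n) (Fin n) ℝ}
    {Φ' : Matrix (Fin n) (Fin n) ℝ} {s : Set ℝ} {t : ℝ} (h : HasDerivWithinAt Φ Φ' s t)
    (v : EuclideanSpace ℝ (Fin n)) :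
    HasDerivWithinAt (fun x => toEuclideanLin (Φ x) v) (toEuclideanLin Φ' v) s t :=
  (LinearMap.toContinuousLinearMap ((LinearMap.applyₗ v).comp
    (toEuclideanLin (𝕜 := ℝ) (m := Fin n) (n := Fin n)).toLinearMap)).hasFDerivAt.comp_hasDerivWithinAt
      t h

theorem toEuclideanLin_mul_apply (A B : Matrix (Fin n) (Fin n) ℝ)
    (v : EuclideanSpace ℝ (Fin n)) :
    toEuclideanLin (A * B) v = toEuclideanLin A (toEuclideanLin B v) := by
  simp [toLpLin_apply, mulVec_mulVec]

theorem toEuclideanLin_one_apply (v : EuclideanSpace ℝ (Fin n)) :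
    toEuclideanLin (1 : Matrix (Fin n) (Fin n) ℝ) v = v := by
  simp

end MatrixBounds

/-- Let `T > 0`, `λ ∈ ℝ`, and let `B₁, B₂ : [0,T] → ℝ^{n×n}` be continuous
such that for `i = 1,2` and every `t ∈ [0,T]` the symmetric part of `Bᵢ(t)` has all eigenvalues
bounded above by `λ`.  Let `Φᵢ` be the fundamental solutions of `Φᵢ' = Bᵢ(t) Φᵢ`, `Φᵢ(0) = I`.
Then for all `0 ≤ t ≤ T`,
`‖Φ₁(t) - Φ₂(t)‖ ≤ (∫₀ᵗ ‖B₁(s) - B₂(s)‖ ds) · e^{λ t}` in the ℓ² operator norm. -/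
theorem fundamental_solution_difference_bound {n : ℕ} (T lam : ℝ) (hT : 0 < T)
    (B₁ B₂ : ℝ → Matrix (Fin n) (Fin n) ℝ)
    (hB₁cont : ContinuousOn B₁ (Set.Icc 0 T)) (hB₂cont : ContinuousOn B₂ (Set.Icc 0 T))
    (hB₁eig : ∀ t ∈ Set.Icc (0 : ℝ) T,
      ∀ μ ∈ spectrum ℝ ((1 / 2 : ℝ) • (B₁ t + (B₁ t)ᵀ)), μ ≤ lam)
    (hB₂eig : ∀ t ∈ Set.Icc (0 : ℝ) T,
      ∀ μ ∈ spectrum ℝ ((1 / 2 : ℝ) • (B₂ t + (B₂ t)ᵀ)), μ ≤ lam)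
    (Φ₁ Φ₂ : ℝ → Matrix (Fin n) (Fin n) ℝ)
    (hΦ₁ : ∀ t ∈ Set.Icc (0 : ℝ) T,
      HasDerivWithinAt Φ₁ (B₁ t * Φ₁ t) (Set.Icc 0 T) t)
    (hΦ₂ : ∀ t ∈ Set.Icc (0 : ℝ) T,
      HasDerivWithinAt Φ₂ (B₂ t * Φ₂ t) (Set.Icc 0 T) t)
    (hΦ₁0 : Φ₁ 0 = 1) (hΦ₂0 : Φ₂ 0 = 1) :
    ∀ t : ℝ, 0 ≤ t → t ≤ T →
      l2OpNorm (Φ₁ t - Φ₂ t) ≤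
        (∫ s in (0 : ℝ)..t, l2OpNorm (B₁ s - B₂ s)) * Real.exp (lam * t) := by
  intro t ht0 htT
  have ht : t ∈ Set.Icc 0 T := ⟨ht0, htT⟩
  have hint : 0 ≤ ∫ s in (0 : ℝ)..t, l2OpNorm (B₁ s - B₂ s) :=
    intervalIntegral.integral_nonneg ht0 fun s _ => l2OpNorm_nonneg _
  refine ContinuousLinearMap.opNorm_le_bound _ (by positivity) fun v => ?_
  have hz : ∀ s ∈ Set.Icc 0 T, ‖toEuclideanLin (Φ₂ s) v‖ ≤ ‖v‖ * Real.exp (lam * s) := by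
    intro s hs
    have := norm_le_mul_exp_of_inner_deriv_le (c := lam) (g := fun _ => 0)
      (fun x hx => hasDerivWithinAt_toEuclideanLin_apply (hΦ₂ x hx) v) continuousOn_const (fun _ _ => le_rfl)
      (fun x hx => by
        rw [toEuclideanLin_mul_apply, mul_zero, mul_zero, add_zero]
        exact inner_toEuclideanLin_le_of_spectrum_le (hB₂eig x hx) _) hs
    simpa [hΦ₂0, toEuclideanLin_one_apply] using this
  have hg : ContinuousOn (fun s => l2OpNorm (B₁ s - B₂ s) * ‖v‖) (Set.Icc 0 T) :=
    (continuous_l2OpNorm.comp_continuousOn (hB₁cont.sub hB₂cont)).mul continuousOn_const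
  have key := norm_le_mul_exp_of_inner_deriv_le (c := lam)
    (fun x hx => hasDerivWithinAt_toEuclideanLin_apply ((hΦ₁ x hx).sub (hΦ₂ x hx)) v) hg
    (fun s _ => mul_nonneg (l2OpNorm_nonneg _) (norm_nonneg v)) (fun x hx => ?_) ht
  · simp only [Pi.sub_apply, hΦ₁0, hΦ₂0, sub_self, map_zero, LinearMap.zero_apply, norm_zero,
      zero_add, intervalIntegral.integral_mul_const] at key
    rw [mul_right_comm]
    exact key
  · have hsplit : B₁ x * Φ₁ x - B₂ x * Φ₂ x =
        B₁ x * (Φ₁ x - Φ₂ x) + (B₁ x - B₂ x) * Φ₂ x := by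
      rw [mul_sub, sub_mul]
      abel
    rw [Pi.sub_apply, hsplit, map_add, LinearMap.add_apply, inner_add_right,
      toEuclideanLin_mul_apply, toEuclideanLin_mul_apply]
    refine add_le_add (inner_toEuclideanLin_le_of_spectrum_le (hB₁eig x hx) _)
      ((real_inner_le_norm _ _).trans (mul_le_mul_of_nonneg_left ?_ (norm_nonneg _)))
    calc _ ≤ l2OpNorm (B₁ x - B₂ x) * ‖toEuclideanLin (Φ₂ x) v‖ := norm_toEuclideanLin_le _ _
      _ ≤ l2OpNorm (B₁ x - B₂ x) * (‖v‖ * Real.exp (lam * x)) :=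
        mul_le_mul_of_nonneg_left (hz x hx) (l2OpNorm_nonneg _)
      _ = _ := by ring
end

section
/- For symmetric n×n real matrices M₁ and M₂ with ordered eigenvalues e₁ ≤ … ≤ e_n and f₁ ≤ … ≤ f_n respectively, one has |e_j - f_j| ≤ ‖M₁ - M₂‖ for every j = 1, …, n, where ‖·‖ is the ℓ² operator norm. -/
open Matrix Polynomial

open scoped InnerProductSpace

/-- A symmetric real matrix has an orthonormal eigenbasis realizing any monotone enumeration of its
eigenvalues. -/
lemma Matrix.IsSymm.exists_orthonormalBasis_of_charpoly_eq {n : ℕ} {M : Matrix (Fin n) (Fin n) ℝ}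
    (hM : M.IsSymm) {e : Fin n → ℝ} (he : Monotone e)
    (hchar : M.charpoly = ∏ j, (X - C (e j))) :
    ∃ b : OrthonormalBasis (Fin n) ℝ (EuclideanSpace ℝ (Fin n)),
      ∀ i, toEuclideanLin M (b i) = e i • b i := by
  have hH : M.IsHermitian := by rwa [IsHermitian, conjTranspose_eq_transpose_of_trivial]
  set σ := Tuple.sort hH.eigenvalues
  have hσ : hH.eigenvalues ∘ σ = e := by
    have hroots : M.charpoly.roots = Finset.univ.val.map e := by
      rw [hchar, roots_prod _ _ (by simp [Finset.prod_ne_zero_iff, X_sub_C_ne_zero])]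
      simp
    rw [hH.roots_charpoly_eq_eigenvalues, Fin.univ_val_map, Fin.univ_val_map,
      Multiset.coe_eq_coe] at hroots
    have hperm := (σ.ofFn_comp_perm hH.eigenvalues).trans hroots
    exact List.ofFn_injective (hperm.eq_of_pairwise'
      (Tuple.monotone_sort hH.eigenvalues).sortedLE_ofFn.pairwise he.sortedLE_ofFn.pairwise)
  refine ⟨hH.eigenvectorBasis.reindex σ.symm, fun i => ?_⟩
  subst hσ
  ext k
  simpa [toLpLin_apply] using congrFun (hH.mulVec_eigenvectorBasis (σ i)) k

/-- The quadratic form of an operator diagonalized by an orthonormal basis. -/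
lemma OrthonormalBasis.inner_apply_self_eq_sum {ι E : Type*} [Fintype ι] [NormedAddCommGroup E]
    [InnerProductSpace ℝ E] (b : OrthonormalBasis ι ℝ E) {T : E →ₗ[ℝ] E} {e : ι → ℝ}
    (hb : ∀ i, T (b i) = e i • b i) (x : E) :
    ⟪x, T x⟫_ℝ = ∑ i, e i * ⟪b i, x⟫_ℝ ^ 2 := by
  have hTx : T x = ∑ i, ⟪b i, x⟫_ℝ • e i • b i := by
    simp_rw [← hb, ← map_smul, ← map_sum, b.sum_repr']
  simp only [hTx, inner_sum, inner_smul_right]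
  refine Finset.sum_congr rfl fun i _ => ?_
  rw [real_inner_comm]
  ring

/-- One half of **Weyl's inequality**: increasingly ordered eigenvalues move up by at most the
operator norm of the perturbation. -/
lemma eigenvalue_le_add_opNorm {n : ℕ} {E : Type*} [NormedAddCommGroup E] [InnerProductSpace ℝ E]
    [FiniteDimensional ℝ E] (b c : OrthonormalBasis (Fin n) ℝ E) {S T : E →ₗ[ℝ] E}
    {e f : Fin n → ℝ} (he : Monotone e) (hf : Monotone f)
    (hb : ∀ i, S (b i) = e i • b i) (hc : ∀ i, T (c i) = f i • c i) (j : Fin n) :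
    e j ≤ f j + ‖LinearMap.toContinuousLinearMap (S - T)‖ := by
  let L : E →ₗ[ℝ] ({i : Fin n // i ≠ j} → ℝ) :=
    LinearMap.pi fun i => (innerSL ℝ (if i.1 < j then b i else c i)).toLinearMap
  have hcard : Module.finrank ℝ ({i : Fin n // i ≠ j} → ℝ) < Module.finrank ℝ E := by
    have := j.pos
    rw [Module.finrank_fintype_fun_eq_card, Module.finrank_eq_card_basis b.toBasis,
      Fintype.card_subtype_compl]
    simpa
  obtain ⟨x, hx, hx0⟩ := (Submodule.ne_bot_iff _).1
    (LinearMap.ker_ne_bot_of_finrank_lt (f := L) hcard)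
  have hL (i : Fin n) (hi : i ≠ j) : ⟪if i < j then b i else c i, x⟫_ℝ = 0 :=
    congrFun (LinearMap.mem_ker.1 hx) ⟨i, hi⟩
  have hbx (i : Fin n) (hi : i < j) : ⟪b i, x⟫_ℝ = 0 := by simpa [hi] using hL i hi.ne
  have hcx (i : Fin n) (hi : j < i) : ⟪c i, x⟫_ℝ = 0 := by simpa [hi.not_gt] using hL i hi.ne'
  have hS : e j * ‖x‖ ^ 2 ≤ ⟪x, S x⟫_ℝ := by
    rw [b.inner_apply_self_eq_sum hb, ← b.sum_sq_inner_right x, Finset.mul_sum]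
    refine Finset.sum_le_sum fun i _ => ?_
    rcases lt_or_ge i j with hi | hi
    · simp [hbx i hi]
    · gcongr
      exact he hi
  have hT : ⟪x, T x⟫_ℝ ≤ f j * ‖x‖ ^ 2 := by
    rw [c.inner_apply_self_eq_sum hc, ← c.sum_sq_inner_right x, Finset.mul_sum]
    refine Finset.sum_le_sum fun i _ => ?_
    rcases lt_or_ge j i with hi | hi
    · simp [hcx i hi]
    · gcongr
      exact hf hi
  have hST : ⟪x, S x⟫_ℝ - ⟪x, T x⟫_ℝ ≤
      ‖LinearMap.toContinuousLinearMap (S - T)‖ * ‖x‖ ^ 2 := by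
    rw [← inner_sub_right]
    calc ⟪x, S x - T x⟫_ℝ ≤ ‖x‖ * ‖S x - T x‖ := real_inner_le_norm _ _
      _ ≤ ‖x‖ * (‖LinearMap.toContinuousLinearMap (S - T)‖ * ‖x‖) := by
        gcongr
        exact (LinearMap.toContinuousLinearMap (S - T)).le_opNorm x
      _ = _ := by ring
  have hpos : 0 < ‖x‖ ^ 2 := by positivity
  exact le_of_mul_le_mul_right (by linarith) hpos

/-- For symmetric `n×n` real matrices `M₁` and `M₂` with ordered eigenvalues
`e₁ ≤ … ≤ e_n` and `f₁ ≤ … ≤ f_n` respectively (listed with multiplicity, i.e. the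
characteristic polynomial is `∏ⱼ (X - eⱼ)` resp. `∏ⱼ (X - fⱼ)`), one has
`|eⱼ - fⱼ| ≤ ‖M₁ - M₂‖` for every `j = 1, …, n`, where `‖·‖` is the ℓ² operator norm. -/
theorem eigenvalue_perturbation_bound {n : ℕ} (M₁ M₂ : Matrix (Fin n) (Fin n) ℝ)
    (h₁ : M₁.IsSymm) (h₂ : M₂.IsSymm)
    (e f : Fin n → ℝ) (he : Monotone e) (hf : Monotone f)
    (hchar₁ : M₁.charpoly = ∏ j, (X - C (e j)))
    (hchar₂ : M₂.charpoly = ∏ j, (X - C (f j))) :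
    ∀ j : Fin n, |e j - f j| ≤ l2OpNorm (M₁ - M₂) := by
  obtain ⟨b, hb⟩ := h₁.exists_orthonormalBasis_of_charpoly_eq he hchar₁
  obtain ⟨c, hc⟩ := h₂.exists_orthonormalBasis_of_charpoly_eq hf hchar₂
  intro j
  have hle := eigenvalue_le_add_opNorm b c he hf hb hc j
  have hge := eigenvalue_le_add_opNorm c b hf he hc hb j
  rw [← neg_sub, map_neg, norm_neg] at hge
  rw [l2OpNorm, map_sub, abs_le]
  constructor <;> linarith
end
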